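/- Among the 4096 residue pairs (a,b) modulo 2⁶ for the polynomials A(a,b) = (-3a²-36b²)(a⁴+36a²b²+432b⁴) and B(a,b) = 2a(a⁴+36a²b²+432b⁴)², exactly 2048 pairs satisfy both 2⁴ | A(a,b) and 2⁶ | B(a,b); these are precisely the pairs with a even. Hence the local density 𝔡₂ of pairs that are not simultaneously non-minimal at 2 equals 1/2. -/

import Mathlib

/-- `A(a,b) = (-3a² - 36b²)(a⁴ + 36a²b² + 432b⁴)`. -/
def Aent {R : Type*} [CommRing R] (a b : R) : R :=
  (-3 * a ^ 2 - 36 * b ^ 2) * (a ^ 4 + 36 * a ^ 2 * b ^ 2 + 432 * b ^ 4)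

/-- `B(a,b) = 2a·(a⁴ + 36a²b² + 432b⁴)²`. -/
def Bent {R : Type*} [CommRing R] (a b : R) : R :=
  2 * a * (a ^ 4 + 36 * a ^ 2 * b ^ 2 + 432 * b ^ 4) ^ 2

theorem parity64 : ∀ a : ZMod (2 ^ 6), (∃ c, a = 2 * c) ∨ ∃ c, a = 2 * c + 1 := by
  intro a
  have h : ((a.val : ℕ) : ZMod (2 ^ 6)) = a := ZMod.natCast_zmod_val a
  rcases Nat.even_or_odd' a.val with ⟨c, hc | hc⟩
  · left; refine ⟨(c : ZMod (2 ^ 6)), ?_⟩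
    rw [← h, hc]; push_cast; ring
  · right; refine ⟨(c : ZMod (2 ^ 6)), ?_⟩
    rw [← h, hc]; push_cast; ring

theorem h64 : (64 : ZMod (2 ^ 6)) = 0 := by decide

theorem key_iff (p : ZMod (2 ^ 6) × ZMod (2 ^ 6)) :
    ((2 ^ 4 : ZMod (2 ^ 6)) ∣ Aent p.1 p.2 ∧ Bent p.1 p.2 = 0) ↔
      (2 : ZMod (2 ^ 6)) ∣ p.1 := by
  obtain ⟨a, b⟩ := p
  constructor
  · rintro ⟨⟨k, hk⟩, -⟩
    rcases parity64 a with ⟨c, rfl⟩ | ⟨c, rfl⟩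
    · exact ⟨c, rfl⟩
    · exfalso
      have h32 : (32 : ZMod (2 ^ 6)) ≠ 0 := by decide
      apply h32
      simp only [Aent] at hk
      -- modulo 2 the quantity `A` is `-3 a ^ 6`, and `a` is odd
      have e : (32 : ZMod (2 ^ 6)) * (2 * c + 1) = 32 := by linear_combination c * h64
      have e2 : (32 : ZMod (2 ^ 6)) * (2 * c + 1) ^ 6 = 32 := by
        linear_combination (1 + (2*c+1) + (2*c+1)^2 + (2*c+1)^3 + (2*c+1)^4 + (2*c+1)^5) * e
      linear_combination (-1) * e2 + 32 * hk + (8 * k + 2 * (2*c+1)^6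
        + (18 * b^2 * ((2*c+1)^4 + 36 * (2*c+1)^2 * b^2 + 432 * b^4)
          + 3 * (2*c+1)^2 * (18 * (2*c+1)^2 * b^2 + 216 * b^4))) * h64
  · rintro ⟨c, hc⟩
    simp only at hc
    subst hc
    refine ⟨⟨(-3 * (2 * c) ^ 2 - 36 * b ^ 2) * (c ^ 4 + 9 * c ^ 2 * b ^ 2 + 27 * b ^ 4), ?_⟩, ?_⟩
    · simp only [Aent]; ring
    · simp only [Bent]
      linear_combination (16 * c * (c ^ 4 + 9 * c ^ 2 * b ^ 2 + 27 * b ^ 4) ^ 2) * h64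

theorem even_iff (a : ZMod (2 ^ 6)) : (2 : ZMod (2 ^ 6)) ∣ a ↔ a.val % 2 = 0 := by
  constructor
  · rintro ⟨c, rfl⟩
    rw [ZMod.val_mul, show (2 : ZMod (2 ^ 6)).val = 2 from rfl]
    omega
  · intro h
    refine ⟨((a.val / 2 : ℕ) : ZMod (2 ^ 6)), ?_⟩
    have h1 : a.val = 2 * (a.val / 2) := by omega
    conv_lhs => rw [← ZMod.natCast_zmod_val a, h1]
    push_cast; rfl

theorem card_even : Nat.card {a : ZMod (2 ^ 6) // (2 : ZMod (2 ^ 6)) ∣ a} = 32 := by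
  rw [Nat.card_congr (Equiv.subtypeEquivRight even_iff)]
  have h : Nat.card {a : Fin 64 // a.val % 2 = 0} = 32 := by
    rw [Nat.card_eq_fintype_card]; decide
  exact h

theorem card_main : Nat.card {p : ZMod (2 ^ 6) × ZMod (2 ^ 6) //
        (2 ^ 4 : ZMod (2 ^ 6)) ∣ Aent p.1 p.2 ∧ Bent p.1 p.2 = 0} = 2048 := by
  rw [Nat.card_congr (Equiv.subtypeEquivRight key_iff)]
  let e : {p : ZMod (2 ^ 6) × ZMod (2 ^ 6) // (2 : ZMod (2 ^ 6)) ∣ p.1} ≃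
      {a : ZMod (2 ^ 6) // (2 : ZMod (2 ^ 6)) ∣ a} × ZMod (2 ^ 6) :=
    { toFun := fun p => (⟨p.1.1, p.2⟩, p.1.2)
      invFun := fun q => ⟨(q.1.1, q.2), q.1.2⟩
      left_inv := fun _ => rfl
      right_inv := fun _ => rfl }
  rw [Nat.card_congr e, Nat.card_prod, card_even, Nat.card_zmod]
  norm_num

/-- Among the `4096` residue pairs `(a,b)` mod `2⁶`, exactly `2048` satisfy both
`2⁴ ∣ A(a,b)` and `2⁶ ∣ B(a,b)`; these are precisely the pairs with `a` even.  Hence the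
local density `𝔡₂` of pairs not simultaneously non-minimal at `2` is `1/2`. -/
theorem stmt15 :
    Nat.card {p : ZMod (2 ^ 6) × ZMod (2 ^ 6) //
        (2 ^ 4 : ZMod (2 ^ 6)) ∣ Aent p.1 p.2 ∧ Bent p.1 p.2 = 0} = 2048 ∧
    (∀ p : ZMod (2 ^ 6) × ZMod (2 ^ 6),
        ((2 ^ 4 : ZMod (2 ^ 6)) ∣ Aent p.1 p.2 ∧ Bent p.1 p.2 = 0) ↔
          (2 : ZMod (2 ^ 6)) ∣ p.1) ∧
    1 - (Nat.card {p : ZMod (2 ^ 6) × ZMod (2 ^ 6) //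
        (2 ^ 4 : ZMod (2 ^ 6)) ∣ Aent p.1 p.2 ∧ Bent p.1 p.2 = 0} : ℝ) / 4096
      = 1 / 2 := by
  refine ⟨card_main, key_iff, ?_⟩
  rw [card_main]
  norm_num
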